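/- arXiv:1912.03305 — 4 statements merged into one kernel-verified Lean document; each statement's English description precedes it below -/
import Mathlib

section
/- Let M ↪ L be a primitive embedding of even lattices with L unimodular, and let N = M^⊥ be the orthogonal complement of M in L. Then the discriminant groups M^♯ = M^∨/M and N^♯ = N^∨/N are isomorphic as abelian groups (indeed M^♯ ≅ N(-1)^♯ as finite quadratic forms). -/
open Matrix

noncomputable section

/-- Integer pairing given by a Gram matrix. -/
def pairZ {n : ℕ} (B : Matrix (Fin n) (Fin n) ℤ) (v w : Fin n → ℤ) : ℤ :=
  v ⬝ᵥ B.mulVec w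

/-- The rational bilinear form associated to an integral Gram matrix. -/
def bq {n : ℕ} (B : Matrix (Fin n) (Fin n) ℤ) :
    LinearMap.BilinForm ℚ (Fin n → ℚ) :=
  Matrix.toBilin' (B.map (Int.cast : ℤ → ℚ))

/-- The canonical map from integer vectors to rational vectors. -/
def iZ (n : ℕ) : (Fin n → ℤ) →ₗ[ℤ] (Fin n → ℚ) where
  toFun x i := (x i : ℚ)
  map_add' x y := by funext i; simp
  map_smul' c x := by funext i; push_cast; simp

/-- The standard lattice `ℤⁿ ⊆ ℚⁿ`. -/
def LZ (n : ℕ) : Submodule ℤ (Fin n → ℚ) := LinearMap.range (iZ n)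

/-- The orthogonal complement of `M` inside `S` with respect to `b`. -/
def orthoIn {n : ℕ} (b : LinearMap.BilinForm ℚ (Fin n → ℚ))
    (M S : Submodule ℤ (Fin n → ℚ)) : Submodule ℤ (Fin n → ℚ) :=
  S ⊓ ⨅ m ∈ (M : Set (Fin n → ℚ)), (LinearMap.ker (b.flip m)).restrictScalars ℤ

/-- The dual lattice `M^∨` of a sublattice `M`, inside `ℚⁿ`. -/
def dualLat {n : ℕ} (b : LinearMap.BilinForm ℚ (Fin n → ℚ))
    (M : Submodule ℤ (Fin n → ℚ)) : Submodule ℤ (Fin n → ℚ) :=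
  (Submodule.span ℚ (M : Set (Fin n → ℚ))).restrictScalars ℤ ⊓
    ⨅ m ∈ (M : Set (Fin n → ℚ)),
      Submodule.comap ((b.flip m).restrictScalars ℤ)
        (LinearMap.range (Algebra.linearMap ℤ ℚ))

/-- The discriminant group `M^♯ = M^∨/M`. -/
abbrev disc {n : ℕ} (b : LinearMap.BilinForm ℚ (Fin n → ℚ))
    (M : Submodule ℤ (Fin n → ℚ)) :=
  (dualLat b M) ⧸ (Submodule.comap (dualLat b M).subtype M)

/-- A lattice is even. -/
def IsEvenLat {n : ℕ} (B : Matrix (Fin n) (Fin n) ℤ) : Prop :=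
  ∀ x : Fin n → ℤ, 2 ∣ pairZ B x x

/-- `M` is a primitive sublattice of `S`. -/
def IsPrimitiveIn {n : ℕ} (M S : Submodule ℤ (Fin n → ℚ)) : Prop :=
  M ≤ S ∧ ∀ x ∈ S, ∀ k : ℤ, k ≠ 0 → k • x ∈ M → x ∈ M

/-- `d` is the divisibility `(v, L)` of `v` in the lattice `ℤⁿ` with Gram matrix `B`:
the greatest positive natural number dividing all pairings of `v` with lattice vectors. -/
def DivIdx {n : ℕ} (B : Matrix (Fin n) (Fin n) ℤ) (v : Fin n → ℤ) (d : ℕ) : Prop :=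
  IsGreatest {e : ℕ | 0 < e ∧ ∀ x : Fin n → ℤ, (e : ℤ) ∣ pairZ B v x} d

/-- The lattice with Gram matrix `B` has signature `(p, q)`. -/
def HasSignature {n : ℕ} (B : Matrix (Fin n) (Fin n) ℤ) (p q : ℕ) : Prop :=
  p + q = n ∧ ∃ P : Matrix (Fin n) (Fin n) ℝ, IsUnit P.det ∧
    Pᵀ * (B.map (Int.cast : ℤ → ℝ)) * P =
      Matrix.diagonal (fun i : Fin n => if (i : ℕ) < p then (1 : ℝ) else -1)

/-- Goursat's lemma for subgroups `A`, `B` that are matched by the relation `x + y ∈ L`. -/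
theorem nonempty_quotient_addEquiv_of_add_mem {E : Type*} [AddCommGroup E]
    (A B M N L : Submodule ℤ E)
    (hM : ∀ x ∈ A, x ∈ M ↔ x ∈ L) (hN : ∀ y ∈ B, y ∈ N ↔ y ∈ L)
    (hAB : ∀ x ∈ A, ∃ y ∈ B, x + y ∈ L) (hBA : ∀ y ∈ B, ∃ x ∈ A, y + x ∈ L) :
    Nonempty ((A ⧸ M.comap A.subtype) ≃+ (B ⧸ N.comap B.subtype)) := by
  let s : (A × B) →ₗ[ℤ] E := A.subtype.coprod B.subtype
  let G : Submodule ℤ (A × B) := L.comap s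
  let f : G →ₗ[ℤ] (A ⧸ M.comap A.subtype) :=
    (M.comap A.subtype).mkQ ∘ₗ LinearMap.fst ℤ A B ∘ₗ G.subtype
  let g : G →ₗ[ℤ] (B ⧸ N.comap B.subtype) :=
    (N.comap B.subtype).mkQ ∘ₗ LinearMap.snd ℤ A B ∘ₗ G.subtype
  have hf : Function.Surjective f := by
    intro q
    obtain ⟨⟨x, hx⟩, rfl⟩ := Submodule.mkQ_surjective _ q
    obtain ⟨y, hy, h⟩ := hAB x hx
    exact ⟨⟨(⟨x, hx⟩, ⟨y, hy⟩), h⟩, rfl⟩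
  have hg : Function.Surjective g := by
    intro q
    obtain ⟨⟨y, hy⟩, rfl⟩ := Submodule.mkQ_surjective _ q
    obtain ⟨x, hx, h⟩ := hBA y hy
    exact ⟨⟨(⟨x, hx⟩, ⟨y, hy⟩), by rw [add_comm] at h; exact h⟩, rfl⟩
  have hker : LinearMap.ker f = LinearMap.ker g := by
    ext ⟨⟨⟨x, hx⟩, ⟨y, hy⟩⟩, h⟩
    have h' : x + y ∈ L := h
    have hxy : x ∈ L ↔ y ∈ L :=
      ⟨fun hx => (Submodule.add_mem_iff_right L hx).1 h',
        fun hy => (Submodule.add_mem_iff_left L hy).1 h'⟩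
    have hf0 : f ⟨(⟨x, hx⟩, ⟨y, hy⟩), h⟩ = 0 ↔ x ∈ M :=
      Submodule.Quotient.mk_eq_zero (M.comap A.subtype)
    have hg0 : g ⟨(⟨x, hx⟩, ⟨y, hy⟩), h⟩ = 0 ↔ y ∈ N :=
      Submodule.Quotient.mk_eq_zero (N.comap B.subtype)
    rw [LinearMap.mem_ker, LinearMap.mem_ker, hf0, hg0, hM x hx, hN y hy, hxy]
  exact ⟨((f.quotKerEquivOfSurjective hf).symm.trans
    ((Submodule.quotEquivOfEq _ _ hker).trans (g.quotKerEquivOfSurjective hg))).toAddEquiv⟩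

theorem exists_int_smul_mem_of_mem_span {E : Type*} [AddCommGroup E] [Module ℚ E]
    (P : Submodule ℤ E) {x : E} (hx : x ∈ Submodule.span ℚ (P : Set E)) :
    ∃ k : ℤ, k ≠ 0 ∧ k • x ∈ P := by
  induction hx using Submodule.span_induction with
  | mem x h => exact ⟨1, one_ne_zero, by simpa using h⟩
  | zero => exact ⟨1, one_ne_zero, by simp⟩
  | add x y _ _ hx hy =>
    obtain ⟨a, ha, hax⟩ := hx
    obtain ⟨c, hc, hcy⟩ := hy
    refine ⟨a * c, mul_ne_zero ha hc, ?_⟩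
    rw [smul_add, mul_comm a c, mul_smul, mul_comm c a, mul_smul]
    exact add_mem (P.smul_mem _ hax) (P.smul_mem _ hcy)
  | smul q x _ hx =>
    obtain ⟨a, ha, hax⟩ := hx
    refine ⟨q.den * a, mul_ne_zero (by exact_mod_cast q.den_ne_zero) ha, ?_⟩
    have h : ((q.den : ℤ) * a) • q • x = q.num • a • x := by
      simp only [← Int.cast_smul_eq_zsmul ℚ, smul_smul]
      congr 1
      push_cast
      rw [mul_right_comm, mul_comm (q.den : ℚ), Rat.mul_den_eq_num]
    rw [h]
    exact P.smul_mem _ hax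

theorem mem_span_of_int_smul_mem {E : Type*} [AddCommGroup E] [Module ℚ E]
    {P : Set E} {x : E} {k : ℤ} (hk : k ≠ 0) (h : k • x ∈ P) : x ∈ Submodule.span ℚ P := by
  have := (Submodule.span ℚ P).smul_mem (k : ℚ)⁻¹ (Submodule.subset_span h)
  rwa [← Int.cast_smul_eq_zsmul ℚ, inv_smul_smul₀ (by exact_mod_cast hk)] at this

theorem span_LZ (n : ℕ) : Submodule.span ℚ (LZ n : Set (Fin n → ℚ)) = ⊤ := by
  rw [eq_top_iff, ← (Pi.basisFun ℚ (Fin n)).span_eq, Submodule.span_le]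
  rintro _ ⟨i, rfl⟩
  refine Submodule.subset_span ⟨Pi.single i 1, ?_⟩
  ext j
  by_cases h : j = i <;> simp [iZ, h]

theorem mem_dualLat {n : ℕ} {b : LinearMap.BilinForm ℚ (Fin n → ℚ)}
    {M : Submodule ℤ (Fin n → ℚ)} {x : Fin n → ℚ} :
    x ∈ dualLat b M ↔ x ∈ Submodule.span ℚ (M : Set (Fin n → ℚ)) ∧
      ∀ m ∈ M, ∃ k : ℤ, (k : ℚ) = b x m := by
  simp [dualLat]

theorem mem_orthoIn {n : ℕ} {b : LinearMap.BilinForm ℚ (Fin n → ℚ)}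
    {M S : Submodule ℤ (Fin n → ℚ)} {x : Fin n → ℚ} :
    x ∈ orthoIn b M S ↔ x ∈ S ∧ ∀ m ∈ M, b x m = 0 := by
  simp [orthoIn]

theorem bq_isSymm {n : ℕ} {B : Matrix (Fin n) (Fin n) ℤ} (hsym : B.IsSymm)
    (x y : Fin n → ℚ) : bq B x y = bq B y x := by
  rw [bq, Matrix.toBilin'_apply', Matrix.toBilin'_apply', dotProduct_comm,
    ← Matrix.vecMul_transpose, ← Matrix.dotProduct_mulVec]
  rw [show (B.map (Int.cast : ℤ → ℚ))ᵀ = B.map Int.cast from hsym.map _]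

theorem bq_iZ {n : ℕ} (B : Matrix (Fin n) (Fin n) ℤ) (v w : Fin n → ℤ) :
    bq B (iZ n v) (iZ n w) = pairZ B v w := by
  simp [bq, Matrix.toBilin'_apply', pairZ, iZ, dotProduct, Matrix.mulVec]

theorem exists_pairZ_eq {n : ℕ} {B : Matrix (Fin n) (Fin n) ℤ} (hsym : B.IsSymm)
    (hunim : IsUnit B.det) (f : (Fin n → ℤ) →ₗ[ℤ] ℤ) :
    ∃ v, ∀ w, pairZ B v w = f w := by
  refine ⟨B⁻¹ *ᵥ fun i => f (Pi.single i 1), fun w => ?_⟩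
  rw [pairZ, Matrix.dotProduct_mulVec, ← Matrix.mulVec_transpose, hsym.eq, Matrix.mulVec_mulVec,
    Matrix.mul_nonsing_inv _ hunim, Matrix.one_mulVec, LinearMap.pi_apply_eq_sum_univ f w]
  simp only [dotProduct, smul_eq_mul]
  refine Finset.sum_congr rfl fun i _ => ?_
  rw [mul_comm]
  congr 2
  ext j
  simp [Pi.single_apply, eq_comm]

/-- A primitive sublattice of `ℤⁿ` is a direct summand. -/
theorem IsPrimitiveIn.exists_projection {n : ℕ} {P : Submodule ℤ (Fin n → ℚ)}
    (hP : IsPrimitiveIn P (LZ n)) :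
    ∃ p : (Fin n → ℤ) →ₗ[ℤ] (Fin n → ℤ),
      (∀ v, iZ n (p v) ∈ P) ∧ ∀ v, iZ n v ∈ P → p v = v := by
  let Q := P.comap (iZ n)
  have : Module.IsTorsionFree ℤ ((Fin n → ℤ) ⧸ Q) := by
    refine .of_smul_eq_zero fun k q h => ?_
    obtain ⟨v, rfl⟩ := Submodule.mkQ_surjective _ q
    rw [or_iff_not_imp_left]
    intro hk
    rw [← map_smul, Submodule.mkQ_apply, Submodule.Quotient.mk_eq_zero] at h
    rw [Submodule.mkQ_apply, Submodule.Quotient.mk_eq_zero]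
    exact hP.2 _ ⟨v, rfl⟩ k hk (by simpa only [map_zsmul] using (show iZ n (k • v) ∈ P from h))
  obtain ⟨s, hs⟩ := Q.mkQ.exists_rightInverse_of_surjective Q.range_mkQ
  have hs' (q) : Q.mkQ (s q) = q := LinearMap.congr_fun hs q
  refine ⟨LinearMap.id - s ∘ₗ Q.mkQ, fun v => ?_, fun v hv => ?_⟩
  · change v - s (Q.mkQ v) ∈ Q
    rw [← Submodule.Quotient.mk_eq_zero, ← Submodule.mkQ_apply, map_sub, hs', sub_self]
  · have : Q.mkQ v = 0 := by
      rw [← LinearMap.mem_ker, Submodule.ker_mkQ]; exact hv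
    simp [-Submodule.mkQ_apply, this]

/-- In a unimodular lattice, every integral functional on a primitive sublattice is the
pairing with a lattice vector. -/
theorem IsPrimitiveIn.exists_bq_eq {n : ℕ} {B : Matrix (Fin n) (Fin n) ℤ} (hsym : B.IsSymm)
    (hunim : IsUnit B.det) {P : Submodule ℤ (Fin n → ℚ)} (hP : IsPrimitiveIn P (LZ n))
    {x : Fin n → ℚ} (hx : ∀ m ∈ P, ∃ k : ℤ, (k : ℚ) = bq B x m) :
    ∃ l ∈ LZ n, ∀ m ∈ P, bq B l m = bq B x m := by
  obtain ⟨p, hp, hp'⟩ := hP.exists_projection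
  choose f hf using fun v => hx _ (hp v)
  let F : (Fin n → ℤ) →ₗ[ℤ] ℤ := (AddMonoidHom.mk' f fun v w => by
    have : ((f (v + w) : ℤ) : ℚ) = (f v + f w : ℤ) := by
      push_cast
      simp only [hf, map_add]
    exact_mod_cast this).toIntLinearMap
  obtain ⟨v, hv⟩ := exists_pairZ_eq hsym hunim F
  refine ⟨iZ n v, ⟨v, rfl⟩, fun m hm => ?_⟩
  obtain ⟨w, rfl⟩ := hP.1 hm
  rw [bq_iZ, hv]
  change ((f w : ℤ) : ℚ) = _
  rw [hf, hp' w hm]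

theorem mem_iff_mem_LZ_of_mem_dualLat {n : ℕ} {b : LinearMap.BilinForm ℚ (Fin n → ℚ)}
    {P : Submodule ℤ (Fin n → ℚ)} (hP : IsPrimitiveIn P (LZ n)) {x : Fin n → ℚ}
    (hx : x ∈ dualLat b P) : x ∈ P ↔ x ∈ LZ n := by
  refine ⟨fun h => hP.1 h, fun h => ?_⟩
  obtain ⟨k, hk, hkx⟩ := exists_int_smul_mem_of_mem_span P (mem_dualLat.1 hx).1
  exact hP.2 x h k hk hkx

theorem isPrimitiveIn_orthoIn {n : ℕ} (b : LinearMap.BilinForm ℚ (Fin n → ℚ))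
    (M S : Submodule ℤ (Fin n → ℚ)) : IsPrimitiveIn (orthoIn b M S) S := by
  refine ⟨inf_le_left, fun x hx k hk h => mem_orthoIn.2 ⟨hx, fun m hm => ?_⟩⟩
  simpa [-zsmul_eq_mul, hk] using (mem_orthoIn.1 h).2 m hm

theorem mem_span_orthoIn_LZ {n : ℕ} {b : LinearMap.BilinForm ℚ (Fin n → ℚ)}
    {M : Submodule ℤ (Fin n → ℚ)} {x : Fin n → ℚ} :
    x ∈ Submodule.span ℚ (orthoIn b M (LZ n) : Set (Fin n → ℚ)) ↔ ∀ m ∈ M, b x m = 0 := by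
  refine ⟨fun h m hm => ?_, fun h => ?_⟩
  · obtain ⟨k, hk, hkx⟩ := exists_int_smul_mem_of_mem_span _ h
    simpa [-zsmul_eq_mul, hk] using (mem_orthoIn.1 hkx).2 m hm
  · obtain ⟨k, hk, hkx⟩ := exists_int_smul_mem_of_mem_span (LZ n) (x := x) (by simp [span_LZ])
    exact mem_span_of_int_smul_mem hk (mem_orthoIn.2 ⟨hkx, fun m hm => by simp [-zsmul_eq_mul, h m hm]⟩)

theorem mem_span_iff_forall_orthoIn {n : ℕ} {B : Matrix (Fin n) (Fin n) ℤ} (hsym : B.IsSymm)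
    (hnd : B.det ≠ 0) {M : Submodule ℤ (Fin n → ℚ)} {x : Fin n → ℚ} :
    x ∈ Submodule.span ℚ (M : Set (Fin n → ℚ)) ↔
      ∀ y ∈ orthoIn (bq B) M (LZ n), bq B x y = 0 := by
  have hdet : (B.map (Int.cast : ℤ → ℚ)).det ≠ 0 := by
    have h := RingHom.map_det (Int.castRingHom ℚ) B
    rw [RingHom.mapMatrix_apply, Int.coe_castRingHom] at h
    rw [← h]
    exact Int.cast_ne_zero.2 hnd
  have hnondeg : (bq B).Nondegenerate :=
    LinearMap.BilinForm.nondegenerate_toBilin'_of_det_ne_zero' _ hdet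
  have hrefl : (bq B).IsRefl := fun x y h => by rw [bq_isSymm hsym, h]
  have horth (y : Fin n → ℚ) :
      y ∈ (bq B).orthogonal (Submodule.span ℚ (M : Set (Fin n → ℚ))) ↔ ∀ m ∈ M, bq B y m = 0 := by
    rw [LinearMap.BilinForm.mem_orthogonal_iff]
    refine ⟨fun h m hm => hrefl _ _ (h m (Submodule.subset_span hm)), fun h m hm => ?_⟩
    obtain ⟨k, hk, hkm⟩ := exists_int_smul_mem_of_mem_span M hm
    have := hrefl _ _ (h _ hkm)
    simpa [-zsmul_eq_mul, hk] using this
  rw [← LinearMap.BilinForm.orthogonal_orthogonal hnondeg hrefl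
    (Submodule.span ℚ (M : Set (Fin n → ℚ))), LinearMap.BilinForm.mem_orthogonal_iff]
  refine ⟨fun h y hy => hrefl _ _ (h y ((horth y).2 (mem_orthoIn.1 hy).2)), fun h y hy => ?_⟩
  obtain ⟨k, hk, hky⟩ :=
    exists_int_smul_mem_of_mem_span _ (mem_span_orthoIn_LZ.2 ((horth y).1 hy))
  have := hrefl _ _ (h _ hky)
  simpa [-zsmul_eq_mul, hk] using this

theorem exists_mem_dualLat_add_mem_LZ {n : ℕ} {B : Matrix (Fin n) (Fin n) ℤ} (hsym : B.IsSymm)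
    (hunim : IsUnit B.det) {P Q : Submodule ℤ (Fin n → ℚ)} (hP : IsPrimitiveIn P (LZ n))
    (hQ : Q ≤ LZ n)
    (hspan : ∀ y, (∀ m ∈ P, bq B y m = 0) → y ∈ Submodule.span ℚ (Q : Set (Fin n → ℚ)))
    (horth : ∀ x ∈ Submodule.span ℚ (P : Set (Fin n → ℚ)), ∀ q ∈ Q, bq B x q = 0)
    {x : Fin n → ℚ} (hx : x ∈ dualLat (bq B) P) :
    ∃ y ∈ dualLat (bq B) Q, x + y ∈ LZ n := by
  rw [mem_dualLat] at hx
  obtain ⟨l, hl, hlx⟩ := hP.exists_bq_eq hsym hunim hx.2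
  refine ⟨l - x, mem_dualLat.2 ⟨hspan _ fun m hm => by simp [hlx m hm], fun q hq => ?_⟩, by simpa⟩
  obtain ⟨v, rfl⟩ := hl
  obtain ⟨w, rfl⟩ := hQ hq
  exact ⟨pairZ B v w, by simp [bq_iZ, horth x hx.1 _ hq]⟩

/-- for a primitive embedding `M ↪ L` of even lattices with `L`
unimodular and `N = M^⊥`, the discriminant groups `M^♯` and `N^♯` are isomorphic
as abelian groups. -/
theorem stmt0 {n : ℕ} (B : Matrix (Fin n) (Fin n) ℤ)
    (hsym : B.IsSymm) (hnd : B.det ≠ 0) (heven : IsEvenLat B)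
    (hunim : IsUnit B.det)
    (M : Submodule ℤ (Fin n → ℚ)) (hprim : IsPrimitiveIn M (LZ n)) :
    Nonempty (disc (bq B) M ≃+ disc (bq B) (orthoIn (bq B) M (LZ n))) := by
  have hN := isPrimitiveIn_orthoIn (bq B) M (LZ n)
  exact nonempty_quotient_addEquiv_of_add_mem _ _ _ _ (LZ n)
    (fun _ => mem_iff_mem_LZ_of_mem_dualLat hprim) (fun _ => mem_iff_mem_LZ_of_mem_dualLat hN)
    (fun _ => exists_mem_dualLat_add_mem_LZ hsym hunim hprim hN.1
      (fun _ => mem_span_orthoIn_LZ.2) fun _ => (mem_span_iff_forall_orthoIn hsym hnd).1)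
    (fun _ => exists_mem_dualLat_add_mem_LZ hsym hunim hN hprim.1
      (fun _ => (mem_span_iff_forall_orthoIn hsym hnd).2) fun _ => mem_span_orthoIn_LZ.1)
end
end

section
/- In the lattice L = U^{⊕3} ⊕ [−2]^{⊕2}, there exists a primitive vector σ with σ² = −2 and divisibility (σ, L) = 2, and the orthogonal complement of any such vector is isometric to U^{⊕3} ⊕ [−2]. -/
open Matrix

noncomputable section

/-- Gram matrix of `U³ ⊕ [-2]²`, the OG6 lattice. -/
def GramOG6 : Matrix (Fin 8) (Fin 8) ℤ :=
  !![0,1,0,0,0,0,0,0;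
     1,0,0,0,0,0,0,0;
     0,0,0,1,0,0,0,0;
     0,0,1,0,0,0,0,0;
     0,0,0,0,0,1,0,0;
     0,0,0,0,1,0,0,0;
     0,0,0,0,0,0,-2,0;
     0,0,0,0,0,0,0,-2]

/-- Gram matrix of `U³ ⊕ [-2]`. -/
def GramT7 : Matrix (Fin 7) (Fin 7) ℤ :=
  !![0,1,0,0,0,0,0;
     1,0,0,0,0,0,0;
     0,0,0,1,0,0,0;
     0,0,1,0,0,0,0;
     0,0,0,0,0,1,0;
     0,0,0,0,1,0,0;
     0,0,0,0,0,0,-2]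

lemma pairZ_gramOG6 (x y : Fin 8 → ℤ) :
    pairZ GramOG6 x y = x 0 * y 1 + x 1 * y 0 + x 2 * y 3 + x 3 * y 2 + x 4 * y 5 + x 5 * y 4
      - 2 * (x 6 * y 6) - 2 * (x 7 * y 7) := by
  simp [pairZ, GramOG6, dotProduct, Matrix.mulVec, Fin.sum_univ_succ]
  ring

/-- `x` and `y` lie in the same orbit of the isometry group of `U³ ⊕ [-2]²`. -/
def SameOrbit (x y : Fin 8 → ℤ) : Prop :=
  ∃ g : (Fin 8 → ℤ) ≃ₗ[ℤ] (Fin 8 → ℤ),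
    (∀ u v, pairZ GramOG6 (g u) (g v) = pairZ GramOG6 u v) ∧ g x = y

lemma SameOrbit.trans {x y z : Fin 8 → ℤ} (hxy : SameOrbit x y) (hyz : SameOrbit y z) :
    SameOrbit x z := by
  obtain ⟨g, hg, rfl⟩ := hxy
  obtain ⟨h, hh, rfl⟩ := hyz
  exact ⟨g.trans h, fun u v => by simp [hg, hh], rfl⟩

lemma sameOrbit_swap_zero_one (x : Fin 8 → ℤ) :
    SameOrbit x ![x 1, x 0, x 2, x 3, x 4, x 5, x 6, x 7] := by
  refine ⟨LinearEquiv.funCongrLeft ℤ ℤ (Equiv.swap 0 1), fun u v => ?_, ?_⟩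
  · simp [pairZ_gramOG6, LinearEquiv.funCongrLeft_apply, LinearMap.funLeft_apply,
      Equiv.swap_apply_def]
    ring
  · ext i
    fin_cases i <;> simp [LinearMap.funLeft_apply, Equiv.swap_apply_def]

lemma sameOrbit_swap_six_seven (x : Fin 8 → ℤ) :
    SameOrbit x ![x 0, x 1, x 2, x 3, x 4, x 5, x 7, x 6] := by
  refine ⟨LinearEquiv.funCongrLeft ℤ ℤ (Equiv.swap 6 7), fun u v => ?_, ?_⟩
  · simp [pairZ_gramOG6, LinearEquiv.funCongrLeft_apply, LinearMap.funLeft_apply,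
      Equiv.swap_apply_def]
    ring
  · ext i
    fin_cases i <;> simp [LinearMap.funLeft_apply, Equiv.swap_apply_def]

lemma sameOrbit_swap_first_second (x : Fin 8 → ℤ) :
    SameOrbit x ![x 2, x 3, x 0, x 1, x 4, x 5, x 6, x 7] := by
  refine ⟨LinearEquiv.funCongrLeft ℤ ℤ (Equiv.swap 0 2 * Equiv.swap 1 3), fun u v => ?_, ?_⟩
  · simp [pairZ_gramOG6, LinearEquiv.funCongrLeft_apply, LinearMap.funLeft_apply,
      Equiv.swap_apply_def]
    ring
  · ext i
    fin_cases i <;> simp [LinearMap.funLeft_apply, Equiv.swap_apply_def]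

lemma sameOrbit_swap_first_third (x : Fin 8 → ℤ) :
    SameOrbit x ![x 4, x 5, x 2, x 3, x 0, x 1, x 6, x 7] := by
  refine ⟨LinearEquiv.funCongrLeft ℤ ℤ (Equiv.swap 0 4 * Equiv.swap 1 5), fun u v => ?_, ?_⟩
  · simp [pairZ_gramOG6, LinearEquiv.funCongrLeft_apply, LinearMap.funLeft_apply,
      Equiv.swap_apply_def]
    ring
  · ext i
    fin_cases i <;> simp [LinearMap.funLeft_apply, Equiv.swap_apply_def]

/-- The Eichler transvection of `U³ ⊕ [-2]²` attached to the first isotropic basis vector and the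
vector `(0, 0, a, b, c, d, s, t)`, as a linear map. -/
def eichlerMap (a b c d s t : ℤ) : (Fin 8 → ℤ) →ₗ[ℤ] (Fin 8 → ℤ) where
  toFun x := ![x 0 - (x 2 * b + x 3 * a + x 4 * d + x 5 * c - 2 * (x 6 * s) - 2 * (x 7 * t))
      + (s ^ 2 + t ^ 2 - a * b - c * d) * x 1, x 1, x 2 + x 1 * a, x 3 + x 1 * b,
      x 4 + x 1 * c, x 5 + x 1 * d, x 6 + x 1 * s, x 7 + x 1 * t]
  map_add' x y := by
    ext i
    fin_cases i <;> simp <;> ring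
  map_smul' k x := by
    ext i
    fin_cases i <;> simp <;> ring

lemma eichlerMap_comp_neg (a b c d s t : ℤ) :
    eichlerMap a b c d s t ∘ₗ eichlerMap (-a) (-b) (-c) (-d) (-s) (-t) = LinearMap.id := by
  refine LinearMap.ext fun x => ?_
  ext i
  fin_cases i <;> (simp [eichlerMap]; try ring)

lemma sameOrbit_eichlerMap (a b c d s t : ℤ) (x : Fin 8 → ℤ) :
    SameOrbit x (eichlerMap a b c d s t x) := by
  refine ⟨LinearEquiv.ofLinearMap (eichlerMap a b c d s t)
    (eichlerMap (-a) (-b) (-c) (-d) (-s) (-t)) (eichlerMap_comp_neg a b c d s t) ?_, fun u v => ?_, rfl⟩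
  · simpa using eichlerMap_comp_neg (-a) (-b) (-c) (-d) (-s) (-t)
  · simp [pairZ_gramOG6, eichlerMap]
    ring

/-- Vectors of square `-2` whose divisibility is even. -/
def IsEvenRoot (x : Fin 8 → ℤ) : Prop :=
  pairZ GramOG6 x x = -2 ∧ ∀ y, 2 ∣ pairZ GramOG6 x y

lemma IsEvenRoot.of_sameOrbit {x y : Fin 8 → ℤ} (hx : IsEvenRoot x) (h : SameOrbit x y) :
    IsEvenRoot y := by
  obtain ⟨g, hg, rfl⟩ := h
  refine ⟨by rw [hg, hx.1], fun z => ?_⟩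
  have := hx.2 (g.symm z)
  rwa [← hg, g.apply_symm_apply] at this

lemma IsEvenRoot.two_dvd_zero {x : Fin 8 → ℤ} (hx : IsEvenRoot x) : 2 ∣ x 0 := by
  simpa [pairZ_gramOG6] using hx.2 ![0, 1, 0, 0, 0, 0, 0, 0]

lemma IsEvenRoot.two_dvd_one {x : Fin 8 → ℤ} (hx : IsEvenRoot x) : 2 ∣ x 1 := by
  simpa [pairZ_gramOG6] using hx.2 ![1, 0, 0, 0, 0, 0, 0, 0]

lemma exists_natAbs_add_mul_lt (x : ℤ) {n : ℤ} (hn : n ≠ 0) :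
    ∃ k, (x + n * k).natAbs < n.natAbs := by
  refine ⟨-(x / n), ?_⟩
  have h : x + n * -(x / n) = x % n := by rw [Int.emod_def]; ring
  have h0 := Int.emod_nonneg x hn
  have h1 := Int.emod_lt_abs x hn
  rw [Int.abs_eq_natAbs] at h1
  rw [h]
  omega

lemma exists_four_mul_sq_add_mul_le (x : ℤ) {n : ℤ} (hn : n ≠ 0) :
    ∃ k, 4 * (x + n * k) ^ 2 ≤ n ^ 2 := by
  have h0 := Int.emod_nonneg x hn
  have h1 := Int.emod_lt_abs x hn
  have h : n * (x / n) = x - x % n := by rw [Int.emod_def]; ring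
  have hs := sq_abs n
  by_cases hc : 2 * (x % n) ≤ |n|
  · refine ⟨-(x / n), ?_⟩
    rw [mul_neg, h]
    nlinarith
  · refine ⟨-(x / n) - n.sign, ?_⟩
    have h2 : n * n.sign = |n| := by rw [mul_comm, Int.sign_mul_self_eq_abs]
    rw [mul_sub, mul_neg, h, h2]
    nlinarith

/-- Reduction to a generator of `[-2]²`, up to sign, when the `U³`-component is a multiple of the first
isotropic basis vector. -/
lemma sameOrbit_of_sq_eq_one (x : Fin 8 → ℤ) (hx : IsEvenRoot x) (h1 : x 1 = 0) (h2 : x 2 = 0)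
    (h3 : x 3 = 0) (h4 : x 4 = 0) (h5 : x 5 = 0) :
    ∃ ε : ℤ, ε ^ 2 = 1 ∧ SameOrbit x ![0, 0, 0, 0, 0, 0, ε, 0] := by
  have key : ∀ y : Fin 8 → ℤ, IsEvenRoot y → y 1 = 0 → y 2 = 0 → y 3 = 0 → y 4 = 0 → y 5 = 0 →
      y 7 = 0 → y 6 ^ 2 = 1 → SameOrbit y ![0, 0, 0, 0, 0, 0, y 6, 0] := by
    intro y hy h1 h2 h3 h4 h5 h7 h6
    obtain ⟨b, hb⟩ := hy.two_dvd_zero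
    convert sameOrbit_eichlerMap 0 0 0 0 (-b * y 6) 0 y using 1
    ext i
    fin_cases i <;> simp [eichlerMap, h1, h2, h3, h4, h5, h7]
    linear_combination -hb + 2 * b * h6
  have hq : x 6 ^ 2 + x 7 ^ 2 = 1 := by
    have := hx.1
    rw [pairZ_gramOG6, h1, h2, h4] at this
    linarith
  by_cases h7 : x 7 = 0
  · exact ⟨x 6, by simpa [h7] using hq, key x hx h1 h2 h3 h4 h5 h7 (by simpa [h7] using hq)⟩
  · have h7' : 0 < x 7 ^ 2 := by positivity
    have h6 : x 6 = 0 := by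
      by_contra h
      have : 0 < x 6 ^ 2 := by positivity
      omega
    have hs := sameOrbit_swap_six_seven x
    have hq' : x 7 ^ 2 = 1 := by simpa [h6] using hq
    exact ⟨x 7, hq', hs.trans (key _ (hx.of_sameOrbit hs) h1 h2 h3 h4 h5 h6 hq')⟩

lemma sameOrbit_of_one_ne_zero (n : ℕ) : ∀ x : Fin 8 → ℤ, (x 1).natAbs = n → x 1 ≠ 0 →
    IsEvenRoot x → ∃ ε : ℤ, ε ^ 2 = 1 ∧ SameOrbit x ![0, 0, 0, 0, 0, 0, ε, 0] := by
  induction n using Nat.strong_induction_on with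
  | _ n ih =>
    intro x hn h1 hx
    have step : ∀ z, SameOrbit x z → (z 1).natAbs < n → z 1 ≠ 0 →
        ∃ ε : ℤ, ε ^ 2 = 1 ∧ SameOrbit x ![0, 0, 0, 0, 0, 0, ε, 0] := by
      intro z hz hlt hne
      obtain ⟨ε, hε, h⟩ := ih _ hlt z rfl hne (hx.of_sameOrbit hz)
      exact ⟨ε, hε, hz.trans h⟩
    obtain ⟨a, ha⟩ := exists_natAbs_add_mul_lt (x 2) h1
    obtain ⟨b, hb⟩ := exists_natAbs_add_mul_lt (x 3) h1
    obtain ⟨c, hc⟩ := exists_natAbs_add_mul_lt (x 4) h1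
    obtain ⟨d, hd⟩ := exists_natAbs_add_mul_lt (x 5) h1
    obtain ⟨s, hs⟩ := exists_four_mul_sq_add_mul_le (x 6) h1
    obtain ⟨t, ht⟩ := exists_four_mul_sq_add_mul_le (x 7) h1
    have hxy := sameOrbit_eichlerMap a b c d s t x
    have hy1 : eichlerMap a b c d s t x 1 = x 1 := rfl
    change (eichlerMap a b c d s t x 2).natAbs < _ at ha
    change (eichlerMap a b c d s t x 3).natAbs < _ at hb
    change (eichlerMap a b c d s t x 4).natAbs < _ at hc
    change (eichlerMap a b c d s t x 5).natAbs < _ at hd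
    change 4 * (eichlerMap a b c d s t x 6) ^ 2 ≤ _ at hs
    change 4 * (eichlerMap a b c d s t x 7) ^ 2 ≤ _ at ht
    generalize eichlerMap a b c d s t x = y at *
    have hy := hx.of_sameOrbit hxy
    rw [hn] at ha hb hc hd
    have hswap := hxy.trans (sameOrbit_swap_zero_one y)
    by_cases h3 : y 3 = 0; swap
    · exact step _ (hxy.trans (sameOrbit_swap_first_second y)) hb h3
    by_cases h5 : y 5 = 0; swap
    · exact step _ (hxy.trans (sameOrbit_swap_first_third y)) hd h5
    by_cases h2 : y 2 = 0; swap
    · exact step _ ((hxy.trans (sameOrbit_swap_first_second y)).trans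
        (sameOrbit_swap_zero_one _)) ha h2
    by_cases h4 : y 4 = 0; swap
    · exact step _ ((hxy.trans (sameOrbit_swap_first_third y)).trans
        (sameOrbit_swap_zero_one _)) hc h4
    have hq : y 0 * x 1 = y 6 ^ 2 + y 7 ^ 2 - 1 := by
      have := hy.1
      rw [pairZ_gramOG6, h2, h4, hy1] at this
      linarith
    have h0lt : (y 0).natAbs < n := by
      have hx2 : 2 ≤ |x 1| := by
        have := hx.two_dvd_one
        rw [Int.abs_eq_natAbs]
        omega
      have habs : |y 0| * |x 1| = |y 6 ^ 2 + y 7 ^ 2 - 1| := by rw [← abs_mul, hq]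
      have hle : |y 6 ^ 2 + y 7 ^ 2 - 1| < |x 1| * |x 1| := by
        have := sq_abs (x 1)
        rw [abs_lt]
        constructor <;> nlinarith [sq_nonneg (y 6), sq_nonneg (y 7)]
      have := lt_of_mul_lt_mul_right (habs.trans_lt hle) (abs_nonneg _)
      rw [Int.abs_eq_natAbs, Int.abs_eq_natAbs] at this
      omega
    by_cases h0 : y 0 = 0; swap
    · exact step _ hswap h0lt h0
    obtain ⟨ε, hε, h⟩ := sameOrbit_of_sq_eq_one _ (hx.of_sameOrbit hswap) h0 h2 h3 h4 h5
    exact ⟨ε, hε, hswap.trans h⟩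

lemma IsEvenRoot.exists_sameOrbit {x : Fin 8 → ℤ} (hx : IsEvenRoot x) :
    ∃ ε : ℤ, ε ^ 2 = 1 ∧ SameOrbit x ![0, 0, 0, 0, 0, 0, ε, 0] := by
  have step : ∀ z, SameOrbit x z → z 1 ≠ 0 →
      ∃ ε : ℤ, ε ^ 2 = 1 ∧ SameOrbit x ![0, 0, 0, 0, 0, 0, ε, 0] := by
    intro z hz hne
    obtain ⟨ε, hε, h⟩ := sameOrbit_of_one_ne_zero _ z rfl hne (hx.of_sameOrbit hz)
    exact ⟨ε, hε, hz.trans h⟩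
  by_cases h1 : x 1 = 0; swap
  · exact sameOrbit_of_one_ne_zero _ x rfl h1 hx
  by_cases h3 : x 3 = 0; swap
  · exact step _ (sameOrbit_swap_first_second x) h3
  by_cases h5 : x 5 = 0; swap
  · exact step _ (sameOrbit_swap_first_third x) h5
  by_cases h2 : x 2 = 0; swap
  · exact step _ ((sameOrbit_swap_first_second x).trans (sameOrbit_swap_zero_one _)) h2
  by_cases h4 : x 4 = 0; swap
  · exact step _ ((sameOrbit_swap_first_third x).trans (sameOrbit_swap_zero_one _)) h4
  exact sameOrbit_of_sq_eq_one x hx h1 h2 h3 h4 h5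

/-- The standard basis of the orthogonal complement of the last but one basis vector. -/
def complBasis : Fin 7 → Fin 8 → ℤ :=
  ![![1, 0, 0, 0, 0, 0, 0, 0], ![0, 1, 0, 0, 0, 0, 0, 0], ![0, 0, 1, 0, 0, 0, 0, 0],
    ![0, 0, 0, 1, 0, 0, 0, 0], ![0, 0, 0, 0, 1, 0, 0, 0], ![0, 0, 0, 0, 0, 1, 0, 0],
    ![0, 0, 0, 0, 0, 0, 0, 1]]

lemma mem_span_complBasis (x : Fin 8 → ℤ) :
    x ∈ Submodule.span ℤ (Set.range complBasis) ↔ x 6 = 0 := by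
  rw [Submodule.mem_span_range_iff_exists_fun]
  constructor
  · rintro ⟨c, rfl⟩
    simp [Fin.sum_univ_succ, complBasis]
  · intro h
    refine ⟨![x 0, x 1, x 2, x 3, x 4, x 5, x 7], ?_⟩
    ext i
    fin_cases i <;> simp [Fin.sum_univ_succ, complBasis, h]

lemma pairZ_complBasis (i j : Fin 7) :
    pairZ GramOG6 (complBasis i) (complBasis j) = GramT7 i j := by
  rw [pairZ_gramOG6]
  fin_cases i <;> fin_cases j <;> rfl

/-- in `L = U³ ⊕ [-2]²` there is a primitive vector `σ` with
`σ² = -2` and divisibility `(σ, L) = 2`, and the orthogonal complement of any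
such vector is isometric to `U³ ⊕ [-2]`. -/
theorem stmt7 :
    (∃ σ : Fin 8 → ℤ, (∀ (m : ℤ) (w : Fin 8 → ℤ), σ = m • w → IsUnit m) ∧
      pairZ GramOG6 σ σ = -2 ∧ DivIdx GramOG6 σ 2) ∧
    ∀ σ : Fin 8 → ℤ, (∀ (m : ℤ) (w : Fin 8 → ℤ), σ = m • w → IsUnit m) →
      pairZ GramOG6 σ σ = -2 → DivIdx GramOG6 σ 2 →
      ∃ f : Fin 7 → Fin 8 → ℤ,
        Submodule.span ℤ (Set.range f) =
          LinearMap.ker (Matrix.toBilin' GramOG6 σ) ∧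
        ∀ i j, pairZ GramOG6 (f i) (f j) = GramT7 i j := by
  refine ⟨⟨![0, 0, 0, 0, 0, 0, 1, 0], fun m w h => ?_, by simp [pairZ_gramOG6], ?_⟩, ?_⟩
  · have h6 := congrFun h 6
    exact IsUnit.of_mul_eq_one (w 6) (by simpa using h6.symm)
  · refine ⟨⟨two_pos, fun x => ?_⟩, fun e he => ?_⟩
    · simp [pairZ_gramOG6]
    · have h := he.2 ![0, 0, 0, 0, 0, 0, 1, 0]
      have h2 : (e : ℤ) ∣ 2 := by simpa [pairZ_gramOG6] using h
      exact Nat.le_of_dvd two_pos (by exact_mod_cast h2)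
  · intro σ _ hsq hdiv
    obtain ⟨ε, hε, g, hg, hgσ⟩ := IsEvenRoot.exists_sameOrbit ⟨hsq, hdiv.1.2⟩
    refine ⟨fun i => g.symm (complBasis i), ?_, fun i j => ?_⟩
    · ext x
      have hrange : Set.range (fun i => g.symm (complBasis i)) =
          (g.symm : (Fin 8 → ℤ) →ₗ[ℤ] (Fin 8 → ℤ)) '' Set.range complBasis := by
        rw [← Set.range_comp]
        rfl
      have hε0 : ε ≠ 0 := by
        rintro rfl
        norm_num at hε
      rw [hrange, Submodule.span_image, Submodule.mem_map_equiv, LinearEquiv.symm_symm,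
        mem_span_complBasis, LinearMap.mem_ker, Matrix.toBilin'_apply']
      change _ ↔ pairZ GramOG6 σ x = 0
      rw [← hg, hgσ, pairZ_gramOG6]
      simp [hε0]
    · rw [← hg, g.apply_symm_apply, g.apply_symm_apply, pairZ_complBasis]
end
end

section
/- Let α, β, γ, δ be integers satisfying α²β²(α+β) = 0, γ²δ²(γ+δ) = 0, together with the condition that the matrix M = [[α,β],[γ,δ]] is invertible over ℤ and M maps the set of classes with nonnegative intersection against both rulings into itself (equivalently, excluding the cases (α,β) = ±(1,−1) and (γ,δ) = ±(1,−1)). Then M is either the identity matrix or the matrix swapping the two basis vectors, [[0,1],[1,0]]. -/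
open Matrix

noncomputable section

/-- Nonnegative integers with `a²b²(a+b) = 0` cannot both be nonzero. -/
theorem eq_zero_or_eq_zero_of_sq_mul_sq_mul_add {a b : ℤ} (ha : 0 ≤ a) (hb : 0 ≤ b)
    (h : a ^ 2 * b ^ 2 * (a + b) = 0) : a = 0 ∨ b = 0 := by
  simp only [mul_eq_zero, pow_eq_zero_iff two_ne_zero] at h
  omega

/-- if `α²β²(α+β) = 0`, `γ²δ²(γ+δ) = 0`, the matrix
`[[α,β],[γ,δ]]` is invertible over `ℤ` and maps the cone of classes with
nonnegative intersection against both rulings into itself, then it is the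
identity or the swap matrix. -/
theorem stmt15 (α β γ δ : ℤ)
    (h1 : α ^ 2 * β ^ 2 * (α + β) = 0)
    (h2 : γ ^ 2 * δ ^ 2 * (γ + δ) = 0)
    (hdet : IsUnit (α * δ - β * γ))
    (hcone : ∀ x y : ℤ, 0 ≤ x → 0 ≤ y →
      0 ≤ α * x + γ * y ∧ 0 ≤ β * x + δ * y) :
    (α = 1 ∧ β = 0 ∧ γ = 0 ∧ δ = 1) ∨
    (α = 0 ∧ β = 1 ∧ γ = 1 ∧ δ = 0) := by
  have hx := hcone 1 0 zero_le_one le_rfl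
  have hy := hcone 0 1 le_rfl zero_le_one
  simp only [mul_one, mul_zero, add_zero, zero_add] at hx hy
  obtain ⟨hα, hβ⟩ := hx
  obtain ⟨hγ, hδ⟩ := hy
  rcases eq_zero_or_eq_zero_of_sq_mul_sq_mul_add hα hβ h1 with rfl | rfl <;>
    rcases eq_zero_or_eq_zero_of_sq_mul_sq_mul_add hγ hδ h2 with rfl | rfl <;>
    simp [Int.isUnit_iff] at hdet ⊢ <;> omega
end
end

section
/- In the lattice L = U^{⊕3} ⊕ [−2]^{⊕2}, the sublattice W = U ⊕ D₄(−1) (respectively U(2) ⊕ D₄(−1)) contains no vector v with v² = −2 and divisibility (v, W) = 2; consequently, by div_L(v) | div_W(v), no vector of W of square −2 has divisibility 2 in L. -/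
open Matrix

noncomputable section

/-- Gram matrix of `U ⊕ D₄(−1)`. -/
def GramW1 : Matrix (Fin 6) (Fin 6) ℤ :=
  !![0,1,0,0,0,0;
     1,0,0,0,0,0;
     0,0,-2,1,0,0;
     0,0,1,-2,1,1;
     0,0,0,1,-2,0;
     0,0,0,1,0,-2]

/-- Gram matrix of `U(2) ⊕ D₄(−1)`. -/
def GramW2 : Matrix (Fin 6) (Fin 6) ℤ :=
  !![0,2,0,0,0,0;
     2,0,0,0,0,0;
     0,0,-2,1,0,0;
     0,0,1,-2,1,1;
     0,0,0,1,-2,0;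
     0,0,0,1,0,-2]

/-- In `U(k) ⊕ D₄(−1)`, in the coordinates of the Gram matrix, a vector whose pairings with the
simple roots of `D₄` are even and for which `k * a * b` is even does not have square `-2`. -/
theorem square_ne_neg_two_of_even {k a b c d e f : ℤ} (hab : 2 ∣ k * (a * b)) (hd : 2 ∣ d)
    (hs : 2 ∣ c + e + f) :
    2 * (k * (a * b)) - 2 * (c ^ 2 + d ^ 2 + e ^ 2 + f ^ 2) + 2 * (d * (c + e + f)) ≠ -2 := by
  intro h
  obtain ⟨m, hm⟩ := hab
  obtain ⟨n, rfl⟩ := hd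
  obtain ⟨p, hp⟩ := hs
  obtain ⟨x, hx⟩ := Int.even_mul_succ_self c
  obtain ⟨y, hy⟩ := Int.even_mul_succ_self e
  obtain ⟨z, hz⟩ := Int.even_mul_succ_self f
  rw [hm, hp] at h
  have key : 2 * (m - x - y - z + p - 2 * n ^ 2 + 2 * (n * p)) = -1 := by linarith
  omega

/-- No vector of square `-2` in `U ⊕ D₄(−1)` or `U(2) ⊕ D₄(−1)` pairs evenly with the lattice. -/
theorem not_forall_two_dvd_pairZ {W : Matrix (Fin 6) (Fin 6) ℤ} (hW : W = GramW1 ∨ W = GramW2)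
    {v : Fin 6 → ℤ} (hv : pairZ W v v = -2) : ¬ ∀ x : Fin 6 → ℤ, (2 : ℤ) ∣ pairZ W v x := by
  intro h
  have hb := h ![1, 0, 0, 0, 0, 0]
  have hc := h ![0, 0, 1, 0, 0, 0]
  have hd := h ![0, 0, 0, 1, 0, 0]
  rcases hW with rfl | rfl
  · simp [pairZ, GramW1, dotProduct, mulVec, Fin.sum_univ_succ] at hb hc hd hv
    refine square_ne_neg_two_of_even (k := 1) (a := v 0) (b := v 1) (c := v 2) (d := v 3)
      (e := v 4) (f := v 5) ?_ ?_ ?_ ?_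
    · simpa using hb.mul_left (v 0)
    · omega
    · omega
    · linarith
  · simp [pairZ, GramW2, dotProduct, mulVec, Fin.sum_univ_succ] at hb hc hd hv
    refine square_ne_neg_two_of_even (k := 2) (a := v 0) (b := v 1) (c := v 2) (d := v 3)
      (e := v 4) (f := v 5) (Dvd.intro _ rfl) ?_ ?_ ?_
    · omega
    · omega
    · linarith

/-- `W = U ⊕ D₄(−1)` (resp. `U(2) ⊕ D₄(−1)`) contains no vector of
square `−2` and divisibility `2`; consequently, for any embedding of `W` into
the OG6 lattice `L`, no vector of `W` of square `−2` has divisibility `2`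
in `L`. -/
theorem stmt16 (W : Matrix (Fin 6) (Fin 6) ℤ) (hW : W = GramW1 ∨ W = GramW2) :
    (∀ v : Fin 6 → ℤ, pairZ W v v = -2 →
      ¬ ∀ x : Fin 6 → ℤ, (2 : ℤ) ∣ pairZ W v x) ∧
    ∀ ι : (Fin 6 → ℤ) →ₗ[ℤ] (Fin 8 → ℤ),
      (∀ x y, pairZ GramOG6 (ι x) (ι y) = pairZ W x y) →
      ∀ v : Fin 6 → ℤ, pairZ W v v = -2 →
        ¬ ∀ x : Fin 8 → ℤ, (2 : ℤ) ∣ pairZ GramOG6 (ι v) x := by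
  refine ⟨fun v hv => not_forall_two_dvd_pairZ hW hv, fun ι hι v hv h => ?_⟩
  exact not_forall_two_dvd_pairZ hW hv fun x => hι v x ▸ h (ι x)
end
end
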